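/- arXiv:math/0602610 — 4 statements merged into one kernel-verified Lean document; each statement's English description precedes it below -/
import Mathlib

section
/- For all n ≥ 1 and κ ∈ ℕ, Worpitzky's identity holds: (κ+1)^n = ∑_{k=0}^{n−1} ⟨n,k⟩·C(n+κ−k, n), where C denotes the binomial coefficient. -/
/-- Number of descents of a permutation of `Fin n`: indices `j` with `j+1 < n`
and `π j > π (j+1)`. -/
noncomputable def descents {n : ℕ} (π : Equiv.Perm (Fin n)) : ℕ :=
  Nat.card {j : Fin n // ∃ h : (j : ℕ) + 1 < n, π ⟨(j : ℕ) + 1, h⟩ < π j}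

/-- The Eulerian number `⟨n,k⟩`: the number of permutations of `Fin n` with
exactly `k` descents. -/
noncomputable def eulerian (n k : ℕ) : ℕ :=
  Nat.card {π : Equiv.Perm (Fin n) // descents π = k}

def GoodSeq (P : ℕ → Prop) (m κ : ℕ) (g : Fin (m + 1) → Fin (κ + 1)) : Prop :=
  ∀ j : Fin m, (g j.castSucc : ℕ) ≤ g j.succ ∧ (P j → (g j.castSucc : ℕ) < g j.succ)

lemma card_orderEmb (n N : ℕ) : Nat.card (Fin n ↪o Fin N) = N.choose n := by
  rw [Nat.card_congr (Set.powersetCard.ofFinEmbEquiv (n := n) (I := Fin N))]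
  rw [Set.powersetCard.card, Nat.card_fin]

open Classical in
noncomputable def goodEquiv (P : ℕ → Prop) (m κ : ℕ) :
    {g : Fin (m + 1) → Fin (κ + 1) // GoodSeq P m κ g} ≃
      (Fin (m + 1) ↪o Fin (m + 1 + κ - Nat.count P m)) where
  toFun g := OrderEmbedding.ofStrictMono
    (fun j => ⟨(g.1 j : ℕ) + j - Nat.count P j, by
      have h1 := (g.1 j).2
      have h2 := j.2
      have h3 : Nat.count P j ≤ j := Nat.count_le _
      have h4 : Nat.count P m ≤ m := Nat.count_le _
      have h5 : Nat.count P m ≤ Nat.count P j + (m - j) := by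
        have := Nat.count_add P j (m - j)
        have h6 : Nat.count (fun k => P (j + k)) (m - j) ≤ m - j := Nat.count_le _
        rw [show (j : ℕ) + (m - j) = m by omega] at this
        omega
      omega⟩) (by
      rw [Fin.strictMono_iff_lt_succ]
      intro j
      have h := g.2 j
      have h3 : Nat.count P j ≤ j := Nat.count_le _
      have h4 := Nat.count_succ P j
      simp only [Fin.lt_def, Fin.val_succ, Fin.val_castSucc]
      by_cases hp : P j
      · have := h.2 hp
        simp only [hp, if_true] at h4
        omega
      · have := h.1
        simp only [hp, if_false] at h4
        omega)
  invFun h :=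
    have key : ∀ j : Fin (m + 1), (j : ℕ) ≤ h j := fun j => by
      induction j using Fin.induction with
      | zero => simp
      | succ j ih =>
        have : h j.castSucc < h j.succ := h.strictMono (Fin.castSucc_lt_succ)
        simp only [Fin.lt_def, Fin.val_succ, Fin.val_castSucc] at *
        omega
    have step : ∀ j : Fin m, (h j.castSucc : ℕ) < h j.succ := fun j =>
      h.strictMono (Fin.castSucc_lt_succ)
    have mono : Monotone (fun j : Fin (m + 1) => (h j : ℕ) + Nat.count P j - j) := by
      rw [Fin.monotone_iff_le_succ]
      intro j
      have h4 := Nat.count_succ P j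
      have := step j
      have k1 := key j.castSucc
      simp only [Fin.val_succ, Fin.val_castSucc] at *
      split_ifs at h4 <;> omega
    ⟨fun j => ⟨(h j : ℕ) + Nat.count P j - j, by
      have h1 := mono (Fin.le_last j)
      have h2 := (h (Fin.last m)).2
      have h4 : Nat.count P m ≤ m := Nat.count_le _
      simp only [Fin.val_last] at h1
      omega⟩, by
      intro j
      have h4 := Nat.count_succ P j
      have := step j
      have k1 := key j.castSucc
      simp only [Fin.val_succ, Fin.val_castSucc] at *
      by_cases hp : P j
      · simp only [hp, if_true] at h4
        omega
      · simp only [hp, if_false] at h4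
        simp only [hp, false_imp_iff, and_true]
        omega⟩
  left_inv g := by
    apply Subtype.ext
    funext j
    apply Fin.ext
    have h3 : Nat.count P j ≤ j := Nat.count_le _
    simp only [OrderEmbedding.coe_ofStrictMono]
    omega
  right_inv h := by
    ext j
    have key : (j : ℕ) ≤ h j := by
      induction j using Fin.induction with
      | zero => simp
      | succ j ih =>
        have : h j.castSucc < h j.succ := h.strictMono (Fin.castSucc_lt_succ)
        simp only [Fin.lt_def, Fin.val_succ, Fin.val_castSucc] at *
        omega
    simp only [OrderEmbedding.coe_ofStrictMono]
    omega

/-- The descent predicate on natural numbers. -/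
def DescAt {n : ℕ} (π : Equiv.Perm (Fin n)) (i : ℕ) : Prop :=
  ∃ h : i + 1 < n, π ⟨i + 1, h⟩ < π ⟨i, by omega⟩

open Classical in
lemma descents_eq (m : ℕ) (π : Equiv.Perm (Fin (m + 1))) :
    descents π = Nat.count (DescAt π) m := by
  rw [descents, Nat.count_eq_card_fintype, ← @Nat.card_eq_fintype_card _ (_)]
  exact Nat.card_congr
    { toFun := fun j => ⟨j.1, by have := j.2.1; omega, j.2⟩
      invFun := fun j => ⟨⟨j.1, by have := j.2.1; omega⟩, j.2.2⟩
      left_inv := fun _ => rfl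
      right_inv := fun _ => rfl }

lemma sort_iff (m κ : ℕ) (π : Equiv.Perm (Fin (m + 1))) (f : Fin (m + 1) → Fin (κ + 1)) :
    Tuple.sort f = π ↔ GoodSeq (DescAt π) m κ (f ∘ π) := by
  have h1 : Tuple.sort f = π ↔
      StrictMono (fun k => toLex ((f ∘ π) k, π k)) := by
    rw [eq_comm, Tuple.eq_sort_iff]
    constructor
    · rintro ⟨h, h'⟩ i j hij
      rw [Prod.Lex.toLex_lt_toLex']
      exact ⟨h hij.le, h' i j hij⟩
    · intro h
      refine ⟨fun i j hij => ?_, fun i j hij => ?_⟩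
      · rcases hij.eq_or_lt with rfl | hij
        · rfl
        · exact (Prod.Lex.toLex_lt_toLex'.1 (h hij)).1
      · exact (Prod.Lex.toLex_lt_toLex'.1 (h hij)).2
  rw [h1, Fin.strictMono_iff_lt_succ]
  refine forall_congr' fun j => ?_
  rw [Prod.Lex.toLex_lt_toLex']
  have hd : DescAt π j ↔ π j.succ < π j.castSucc :=
    ⟨fun ⟨_, h⟩ => h, fun h => ⟨by omega, h⟩⟩
  have hne : π j.castSucc ≠ π j.succ := fun h => by
    have := π.injective h
    exact absurd this (Fin.castSucc_lt_succ).ne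
  rw [hd]
  simp only [Fin.le_def, Fin.lt_def, Fin.ext_iff, ne_eq] at *
  generalize ((f ∘ π) j.castSucc : ℕ) = a at *
  generalize ((f ∘ π) j.succ : ℕ) = b at *
  omega

lemma card_sort (m κ : ℕ) (π : Equiv.Perm (Fin (m + 1))) :
    Nat.card {f : Fin (m + 1) → Fin (κ + 1) // Tuple.sort f = π} =
      (m + 1 + κ - descents π).choose (m + 1) := by
  classical
  rw [descents_eq, ← card_orderEmb]
  refine Nat.card_congr (Equiv.trans ?_ (goodEquiv (DescAt π) m κ))
  refine Equiv.subtypeEquiv (Equiv.arrowCongr π.symm (Equiv.refl _)) fun f => ?_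
  rw [sort_iff]
  rfl

theorem stmt14 (n κ : ℕ) (hn : 1 ≤ n) :
    (κ + 1) ^ n = ∑ k ∈ Finset.range n, eulerian n k * Nat.choose (n + κ - k) n := by
  classical
  obtain ⟨m, rfl⟩ : ∃ m, n = m + 1 := ⟨n - 1, by omega⟩
  have h1 : (κ + 1) ^ (m + 1) = ∑ π : Equiv.Perm (Fin (m + 1)),
      (m + 1 + κ - descents π).choose (m + 1) := by
    simp_rw [← card_sort]
    rw [← Nat.card_sigma, Nat.card_congr (Equiv.sigmaFiberEquiv _)]
    simp
  have h2 : ∀ π ∈ (Finset.univ : Finset (Equiv.Perm (Fin (m + 1)))),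
      descents π ∈ Finset.range (m + 1) := by
    intro π _
    rw [descents_eq, Finset.mem_range, Nat.lt_succ_iff]
    exact Nat.count_le _
  rw [h1, ← Finset.sum_fiberwise_of_maps_to h2]
  refine Finset.sum_congr rfl fun k _ => ?_
  rw [Finset.sum_congr rfl (g := fun _ => (m + 1 + κ - k).choose (m + 1))
    (fun π hπ => by rw [(Finset.mem_filter.1 hπ).2]), Finset.sum_const, smul_eq_mul, eulerian,
    Nat.card_eq_fintype_card, Fintype.card_subtype]
end

section
/- Let n ≥ 1, κ ∈ ℕ, and let π be a permutation of Fin n with exactly k descents. Then the number of functions f : Fin n → Fin (κ+1) such that f(π(j)) ≤ f(π(j+1)) for all 0 ≤ j ≤ n−2, and moreover f(π(j)) < f(π(j+1)) whenever π(j) > π(j+1), equals the binomial coefficient C(n+κ−k, n). -/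
lemma aux_card (m κ k : ℕ) (hk : k ≤ m) (D : ℕ → Prop) (c : ℕ → ℕ) (h0 : c 0 = 0)
    (hD : ∀ j, D j → c (j + 1) = c j) (hN : ∀ j, ¬ D j → c (j + 1) = c j + 1)
    (hm : c m + k = m) (π : Equiv.Perm (Fin (m + 1))) :
    Nat.card {f : Fin (m + 1) → Fin (κ + 1) //
      ∀ (j : ℕ) (h : j + 1 < m + 1),
        f (π ⟨j, Nat.lt_of_succ_lt h⟩) ≤ f (π ⟨j + 1, h⟩) ∧
        (D j → f (π ⟨j, Nat.lt_of_succ_lt h⟩) < f (π ⟨j + 1, h⟩))} =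
      Nat.choose (m + 1 + κ - k) (m + 1) := by
  have hmono : Monotone c := monotone_nat_of_le_succ fun j => by
    by_cases h : D j
    · rw [hD j h]
    · rw [hN j h]; omega
  have hc : ∀ j : Fin (m + 1), c j ≤ c m := fun j => hmono (by omega)
  have key : ∀ g : Fin (m + 1) ↪o Fin (m + 1 + κ - k),
      Monotone (fun j : Fin (m + 1) => ((g j : ℕ) : ℤ) - c j) := by
    intro g
    rw [Fin.monotone_iff_le_succ]
    intro i
    have h1 : g i.castSucc < g i.succ := g.strictMono i.castSucc_lt_succ
    have h2 : (g i.castSucc : ℕ) < g i.succ := h1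
    by_cases h : D i
    · have := hD i h
      simp only [Fin.val_succ, Fin.val_castSucc]; omega
    · have := hN i h
      simp only [Fin.val_succ, Fin.val_castSucc]; omega
  have lo : ∀ (g : Fin (m + 1) ↪o Fin (m + 1 + κ - k)) (j : Fin (m + 1)), c j ≤ g j := by
    intro g j
    have h := key g (Fin.zero_le j)
    simp only [Fin.val_zero, h0] at h
    omega
  have hi : ∀ (g : Fin (m + 1) ↪o Fin (m + 1 + κ - k)) (j : Fin (m + 1)),
      (g j : ℕ) - c j < κ + 1 := by
    intro g j
    have h := key g (Fin.le_last j)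
    simp only [Fin.val_last] at h
    have := (g (Fin.last m)).isLt
    omega
  have e : {f : Fin (m + 1) → Fin (κ + 1) //
      ∀ (j : ℕ) (h : j + 1 < m + 1),
        f (π ⟨j, Nat.lt_of_succ_lt h⟩) ≤ f (π ⟨j + 1, h⟩) ∧
        (D j → f (π ⟨j, Nat.lt_of_succ_lt h⟩) < f (π ⟨j + 1, h⟩))} ≃
      (Fin (m + 1) ↪o Fin (m + 1 + κ - k)) :=
    { toFun := fun f => OrderEmbedding.ofStrictMono
        (fun j => ⟨(f.1 (π j) : ℕ) + c j, by
          have := hc j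
          have := (f.1 (π j)).isLt
          omega⟩) (by
          rw [Fin.strictMono_iff_lt_succ]
          intro i
          obtain ⟨h1, h2⟩ := f.2 i (by omega)
          rw [Fin.lt_def]
          change (f.1 (π i.castSucc) : ℕ) + c i < (f.1 (π i.succ) : ℕ) + c (i + 1)
          have h1 : (f.1 (π i.castSucc) : ℕ) ≤ (f.1 (π i.succ) : ℕ) := h1
          by_cases h : D i
          · have h2 : (f.1 (π i.castSucc) : ℕ) < (f.1 (π i.succ) : ℕ) := h2 h
            have := hD i h
            omega
          · have := hN i h
            omega)
      invFun := fun g => ⟨fun i => ⟨(g (π.symm i) : ℕ) - c (π.symm i), hi g _⟩, by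
        intro j h
        simp only [Equiv.symm_apply_apply, Fin.mk_le_mk, Fin.mk_lt_mk]
        have h1 : g ⟨j, Nat.lt_of_succ_lt h⟩ < g ⟨j + 1, h⟩ := g.strictMono (by simp)
        rw [Fin.lt_def] at h1
        have l1 := lo g ⟨j, Nat.lt_of_succ_lt h⟩
        have l2 := lo g ⟨j + 1, h⟩
        simp only at l1 l2
        by_cases hd : D j
        · have := hD j hd
          exact ⟨by omega, fun _ => by omega⟩
        · have := hN j hd
          exact ⟨by omega, fun h => absurd h hd⟩⟩
      left_inv := by
        intro f
        ext i
        simp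
      right_inv := by
        intro g
        ext j
        have := lo g j
        simp
        omega }
  rw [Nat.card_congr e, Nat.card_congr Set.powersetCard.ofFinEmbEquiv]
  rw [Set.powersetCard.card, Nat.card_fin]

theorem stmt15 (n κ : ℕ) (hn : 1 ≤ n) (π : Equiv.Perm (Fin n)) (k : ℕ)
    (hk : descents π = k) :
    Nat.card {f : Fin n → Fin (κ + 1) //
      ∀ (j : ℕ) (h : j + 1 < n),
        f (π ⟨j, Nat.lt_of_succ_lt h⟩) ≤ f (π ⟨j + 1, h⟩) ∧
        (π ⟨j + 1, h⟩ < π ⟨j, Nat.lt_of_succ_lt h⟩ →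
          f (π ⟨j, Nat.lt_of_succ_lt h⟩) < f (π ⟨j + 1, h⟩))} =
      Nat.choose (n + κ - k) n := by

  classical
  obtain ⟨m, rfl⟩ : ∃ m, n = m + 1 := ⟨n - 1, by omega⟩
  set D : ℕ → Prop := fun j => ∃ h : j + 1 < m + 1, π ⟨j + 1, h⟩ < π ⟨j, Nat.lt_of_succ_lt h⟩
    with hDdef
  have hcount : Nat.count D m = k := by
    rw [← hk, descents, Nat.count_eq_card_filter_range, ← Nat.card_eq_finsetCard]
    refine Nat.card_congr
      { toFun := fun x => ⟨⟨x.1, ?_⟩, ?_⟩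
        invFun := fun y => ⟨y.1, ?_⟩
        left_inv := fun x => rfl
        right_inv := fun y => rfl }
    · have := x.2
      simp only [Finset.mem_filter, Finset.mem_range] at this
      omega
    · have := x.2
      simp only [Finset.mem_filter, Finset.mem_range] at this
      exact this.2
    · obtain ⟨h, h'⟩ := y.2
      simp only [Finset.mem_filter, Finset.mem_range]
      exact ⟨by omega, h, h'⟩
  have hsum : ∀ j, Nat.count (fun i => ¬ D i) j + Nat.count D j = j := by
    intro j
    induction j with
    | zero => simp
    | succ j ih =>
      rw [Nat.count_succ, Nat.count_succ]
      by_cases h : D j <;> simp [h] <;> omega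
  have hm := hsum m
  rw [hcount] at hm
  rw [← aux_card m κ k (by omega) D (Nat.count (fun i => ¬ D i)) (by simp)
    (fun j h => by simp [Nat.count_succ, h]) (fun j h => by simp [Nat.count_succ, h]) hm π]
  refine Nat.card_congr (Equiv.subtypeEquivRight fun f => ?_)
  refine forall_congr' fun j => forall_congr' fun h => and_congr_right fun _ => ?_
  exact ⟨fun H hd => H hd.2, fun H hd => H ⟨h, hd⟩⟩
end

section
/- For all n ≥ 1 and 0 ≤ k ≤ n−1, the Eulerian number satisfies the explicit formula (as an identity in ℤ): ⟨n,k⟩ = ∑_{j=0}^{k} (−1)^j · C(n+1, j) · (k+1−j)^n, where C denotes the binomial coefficient. -/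
/-- Descent indicator of a sequence of naturals. -/
def dInd (g : ℕ → ℕ) (j : ℕ) : ℕ := if g (j + 1) < g j then 1 else 0

/-- Extension of a permutation to a sequence of naturals. -/
def extP {n : ℕ} (π : Equiv.Perm (Fin n)) (j : ℕ) : ℕ := if h : j < n then (π ⟨j, h⟩ : ℕ) else 0

theorem descents_eq_s16 {n : ℕ} (π : Equiv.Perm (Fin n)) :
    descents π = ∑ j ∈ Finset.range (n - 1), dInd (extP π) j := by
  classical
  unfold descents
  rw [Nat.card_eq_fintype_card, Fintype.card_subtype]
  simp only [dInd]
  rw [← Finset.card_filter]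
  apply Finset.card_bij (fun (j : Fin n) _ => (j : ℕ))
  · intro j hj
    simp only [Finset.mem_filter, Finset.mem_univ, true_and, Finset.mem_range] at hj ⊢
    obtain ⟨h, h2⟩ := hj
    refine ⟨by omega, ?_⟩
    simp only [extP, h, j.2, dif_pos]
    exact h2
  · intro a _ b _ h
    exact Fin.ext h
  · intro b hb
    simp only [Finset.mem_filter, Finset.mem_range] at hb
    obtain ⟨h, h2⟩ := hb
    have h3 : b + 1 < n := by omega
    have h4 : b < n := by omega
    refine ⟨⟨b, h4⟩, ?_, rfl⟩
    simp only [extP, h3, h4, dif_pos] at h2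
    simp only [Finset.mem_filter, Finset.mem_univ, true_and]
    exact ⟨h3, h2⟩

theorem sum_insert (n p : ℕ) (hp : p ≤ n) (g g' : ℕ → ℕ) (hg : ∀ j < n, g j < n)
    (h1 : ∀ j < p, g' j = g j) (h2 : g' p = n) (h3 : ∀ j, p ≤ j → j < n → g' (j + 1) = g j) :
    (∑ j ∈ Finset.range n, dInd g' j) + (if 0 < p ∧ p < n then dInd g (p - 1) else 0)
      = (∑ j ∈ Finset.range (n - 1), dInd g j) + (if p < n then 1 else 0) := by
  rcases hp.lt_or_eq with hlt | rfl
  · obtain ⟨q, rfl⟩ := Nat.exists_eq_add_of_lt hlt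
    rcases p with _ | r
    · have e0 : dInd g' 0 = 1 := by
        unfold dInd
        rw [h2, h3 0 le_rfl hlt, if_pos (hg 0 hlt)]
      have e : ∀ j ∈ Finset.range q, dInd g' (j + 1) = dInd g j := by
        intro j hj
        rw [Finset.mem_range] at hj
        unfold dInd
        rw [h3 (j + 1) (by omega) (by omega), h3 j (by omega) (by omega)]
      simp only [Nat.zero_add] at *
      rw [Finset.sum_range_succ', e0, Finset.sum_congr rfl e]
      simp
    · have a1 : r + 1 + q + 1 = r + 1 + 1 + q := by ring
      have a2 : r + 1 + q + 1 - 1 = r + 1 + q := by omega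
      rw [a2, a1, Finset.sum_range_add _ (r + 1 + 1) q, Finset.sum_range_add _ (r + 1) q,
        Finset.sum_range_succ _ (r + 1), Finset.sum_range_succ _ r, Finset.sum_range_succ _ r]
      have e0 : dInd g' (r + 1) = 1 := by
        unfold dInd
        rw [h2, h3 (r + 1) le_rfl hlt, if_pos (hg _ hlt)]
      have e1 : dInd g' r = 0 := by
        unfold dInd
        rw [h2, h1 r (by omega), if_neg]
        have := hg r (by omega)
        omega
      have e2 : ∀ j ∈ Finset.range r, dInd g' j = dInd g j := by
        intro j hj
        rw [Finset.mem_range] at hj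
        unfold dInd
        rw [h1 (j + 1) (by omega), h1 j (by omega)]
      have e3 : ∀ j ∈ Finset.range q, dInd g' (r + 1 + 1 + j) = dInd g (r + 1 + j) := by
        intro j hj
        rw [Finset.mem_range] at hj
        have b1 : r + 1 + 1 + j = r + 1 + j + 1 := by ring
        unfold dInd
        rw [b1, h3 (r + 1 + j + 1) (by omega) (by omega), h3 (r + 1 + j) (by omega) (by omega)]
      rw [e0, e1, Finset.sum_congr rfl e2, Finset.sum_congr rfl e3, if_pos (by omega),
        if_pos (by omega)]
      simp only [Nat.add_sub_cancel]
      ring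
  · rcases p with _ | m
    · simp
    · rw [Finset.sum_range_succ]
      have e1 : dInd g' m = 0 := by
        unfold dInd
        rw [h2, h1 m (by omega), if_neg]
        have := hg m (by omega)
        omega
      have e2 : ∀ j ∈ Finset.range m, dInd g' j = dInd g j := by
        intro j hj
        rw [Finset.mem_range] at hj
        unfold dInd
        rw [h1 (j + 1) (by omega), h1 j (by omega)]
      rw [e1, Finset.sum_congr rfl e2]
      simp

/-- Insert the maximal value at position `p`. -/
def insP {n : ℕ} (x : Fin (n + 1) × Equiv.Perm (Fin n)) : Equiv.Perm (Fin (n + 1)) :=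
  ((finSuccEquiv' x.1).trans (Equiv.optionCongr x.2)).trans (finSuccEquiv' (Fin.last n)).symm

theorem insP_self {n : ℕ} (p : Fin (n + 1)) (σ : Equiv.Perm (Fin n)) :
    insP (p, σ) p = Fin.last n := by
  simp [insP]

theorem insP_succAbove {n : ℕ} (p : Fin (n + 1)) (σ : Equiv.Perm (Fin n)) (i : Fin n) :
    insP (p, σ) (p.succAbove i) = (σ i).castSucc := by
  simp [insP]

theorem insP_bij (n : ℕ) : Function.Bijective (@insP n) := by
  rw [Fintype.bijective_iff_injective_and_card]
  constructor
  · rintro ⟨p, σ⟩ ⟨q, τ⟩ h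
    have hpq : p = q := by
      apply (insP (q, τ)).injective
      rw [insP_self, ← h, insP_self]
    subst hpq
    congr 1
    ext i
    have := insP_succAbove p σ i
    rw [h, insP_succAbove] at this
    have := congrArg Fin.val this
    simpa using this.symm
  · simp [Fintype.card_perm, Nat.factorial_succ]

theorem descents_insP {n : ℕ} (p : Fin (n + 1)) (σ : Equiv.Perm (Fin n)) :
    descents (insP (p, σ)) + (if 0 < (p : ℕ) ∧ (p : ℕ) < n then dInd (extP σ) (p - 1) else 0)
      = descents σ + (if (p : ℕ) < n then 1 else 0) := by
  rw [descents_eq_s16, descents_eq_s16]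
  apply sum_insert n p (by omega)
  · intro j hj
    simp [extP, hj]
  · intro j hj
    have hn : j < n := by omega
    have hn1 : j < n + 1 := by omega
    have := insP_succAbove p σ ⟨j, hn⟩
    rw [Fin.succAbove_of_castSucc_lt _ _ (by simpa [Fin.lt_def] using hj)] at this
    simp only [extP, hn, hn1, dif_pos]
    exact congrArg Fin.val this
  · have := insP_self p σ
    simp only [extP, p.2, dif_pos]
    exact congrArg Fin.val this
  · intro j hj hn
    have hn1 : j + 1 < n + 1 := by omega
    have := insP_succAbove p σ ⟨j, hn⟩
    rw [Fin.succAbove_of_le_castSucc _ _ (by simpa [Fin.le_def] using hj)] at this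
    simp only [extP, hn, hn1, dif_pos]
    exact congrArg Fin.val this

theorem eul_sum (n k : ℕ) :
    (eulerian n k : ℤ) = ∑ π : Equiv.Perm (Fin n), if descents π = k then 1 else 0 := by
  classical
  unfold eulerian
  rw [Nat.card_eq_fintype_card, Fintype.card_subtype, Finset.card_filter]
  push_cast
  rfl

theorem sum_pos (n k : ℕ) (σ : Equiv.Perm (Fin n)) :
    (∑ p : Fin (n + 1), if descents (insP (p, σ)) = k then (1 : ℤ) else 0)
      = ((descents σ : ℤ) + 1) * (if descents σ = k then 1 else 0)
        + ((n : ℤ) - descents σ) * (if descents σ + 1 = k then 1 else 0) := by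
  have hd := descents_insP (σ := σ)
  have hs := descents_eq_s16 σ
  generalize extP σ = g at hd hs
  rcases n with _ | m
  · have h0 := hd 0
    have : descents σ = 0 := by rw [hs]; simp
    rw [Fin.sum_univ_succ, Fin.sum_univ_zero]
    simp only [this] at h0 ⊢
    have h0' : descents (insP (0, σ)) = 0 := by simpa using h0
    simp only [h0']
    simp
  · rw [Fin.sum_univ_castSucc, Fin.sum_univ_succ]
    have hlast := hd (Fin.last (m + 1))
    have hzero := hd (Fin.castSucc 0)
    simp at hlast hzero
    have hmid : ∀ i : Fin m, (if descents (insP (i.succ.castSucc, σ)) = k then (1 : ℤ) else 0)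
        = (dInd g i : ℤ) * (if descents σ = k then 1 else 0)
          + (1 - (dInd g i : ℤ)) * (if descents σ + 1 = k then 1 else 0) := by
      intro i
      have := hd i.succ.castSucc
      simp at this
      by_cases hh : g (i + 1) < g i
      · have e : dInd g i = 1 := by simp [dInd, hh]
        rw [e] at this ⊢
        have : descents (insP (i.succ.castSucc, σ)) = descents σ := by simpa using this
        rw [this]; simp
      · have e : dInd g i = 0 := by simp [dInd, hh]
        rw [e] at this ⊢
        have : descents (insP (i.succ.castSucc, σ)) = descents σ + 1 := by simpa using this
        rw [this]; simp
    rw [Finset.sum_congr rfl (fun i _ => hmid i)]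
    rw [Finset.sum_add_distrib, ← Finset.sum_mul, ← Finset.sum_mul, Finset.sum_sub_distrib]
    have hs' : ∑ i : Fin m, (dInd g i : ℤ) = (descents σ : ℤ) := by
      rw [hs, Fin.sum_univ_eq_sum_range (fun j => (dInd g j : ℤ))]
      simp
    rw [hs']
    simp only [Fin.castSucc_zero, hlast, hzero]
    rw [Finset.sum_const, Finset.card_univ, Fintype.card_fin, nsmul_eq_mul]
    push_cast
    ring

theorem eul_rec (n k : ℕ) : (eulerian (n + 1) k : ℤ)
    = ((k : ℤ) + 1) * eulerian n k
      + ∑ σ : Equiv.Perm (Fin n), ((n : ℤ) - descents σ) * (if descents σ + 1 = k then 1 else 0) := by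
  rw [eul_sum, ← (insP_bij n).sum_comp
    (fun π => if descents π = k then (1 : ℤ) else 0), Fintype.sum_prod_type_right]
  rw [Finset.sum_congr rfl (fun σ _ => sum_pos n k σ), Finset.sum_add_distrib, eul_sum,
    Finset.mul_sum]
  congr 1
  apply Finset.sum_congr rfl
  intro σ _
  split_ifs with h
  · rw [h]
  · simp

theorem eul_zero (n : ℕ) : (eulerian (n + 1) 0 : ℤ) = eulerian n 0 := by
  rw [eul_rec]; simp

theorem eul_succ (n k : ℕ) : (eulerian (n + 1) (k + 1) : ℤ)
    = ((k : ℤ) + 2) * eulerian n (k + 1) + ((n : ℤ) - k) * eulerian n k := by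
  rw [eul_rec, eul_sum n k, Finset.mul_sum]
  have e : (((k + 1 : ℕ) : ℤ) + 1) = (k : ℤ) + 2 := by push_cast; ring
  rw [e]
  congr 1
  · apply Finset.sum_congr rfl
    intro σ _
    simp only [Nat.add_right_cancel_iff]
    split_ifs with h
    · rw [h]
    · simp

theorem eul_formula (n : ℕ) : ∀ k : ℕ, (eulerian n k : ℤ) =
      ∑ j ∈ Finset.range (k + 1),
        (-1 : ℤ) ^ j * (Nat.choose (n + 1) j : ℤ) * ((k : ℤ) + 1 - (j : ℤ)) ^ n := by
  induction n with
  | zero =>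
    intro k
    rw [eul_sum]
    have h : ∀ π : Equiv.Perm (Fin 0), descents π = 0 := by
      intro π; rw [descents_eq_s16]; simp
    simp only [h]
    rcases k with _ | k
    · simp
    · rw [Finset.sum_range_succ', Finset.sum_range_succ']
      simp [Nat.choose_eq_zero_of_lt]
  | succ n ih =>
    intro k
    rcases k with _ | k
    · rw [eul_zero, ih]; simp
    · rw [eul_succ, ih, ih, Finset.sum_range_succ', Finset.sum_range_succ' _ (k + 1), mul_add,
        Finset.mul_sum, Finset.mul_sum, add_right_comm, ← Finset.sum_add_distrib]
      congr 1
      · apply Finset.sum_congr rfl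
        intro j hj
        have hc : (Nat.choose (n + 1) (j + 1) : ℤ) * (j + 1) = Nat.choose (n + 1) j * (n + 1 - j) := by
          rcases le_or_gt j (n + 1) with h | h
          · have := Nat.choose_succ_right_eq (n + 1) j
            zify [h] at this
            exact this
          · rw [Nat.choose_eq_zero_of_lt h, Nat.choose_eq_zero_of_lt (by omega)]
            simp
        rw [Nat.choose_succ_succ (n + 1) j]
        push_cast
        have e : (k : ℤ) + 1 + 1 - (j + 1) = k + 1 - j := by ring
        rw [e]
        linear_combination (-(-1 : ℤ) ^ j * (k + 1 - j) ^ n) * hc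
      · push_cast; simp; ring

theorem stmt16 (n k : ℕ) (hn : 1 ≤ n) (hk : k ≤ n - 1) :
    (eulerian n k : ℤ) =
      ∑ j ∈ Finset.range (k + 1),
        (-1 : ℤ) ^ j * (Nat.choose (n + 1) j : ℤ) * ((k : ℤ) + 1 - (j : ℤ)) ^ n := by
  exact eul_formula n k
end

section
/- For every ε > 0, the proportion of permutations of Fin n whose number of descents deviates from (n−1)/2 by at least ε(n−1) tends to 0 as n → ∞; explicitly, (1/n!)·#{π ∈ Sym(Fin n) : |D(π) − (n−1)/2| ≥ ε·(n−1)} → 0 as n → ∞. -/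
/-- The sign of the step `j` of `π`: `1` at a descent, `-1` at an ascent. -/
noncomputable def stepSign {m : ℕ} (j : Fin m) (π : Equiv.Perm (Fin (m + 1))) : ℝ :=
  if π j.succ < π j.castSucc then 1 else -1

lemma descents_eq_s19 {m : ℕ} (π : Equiv.Perm (Fin (m + 1))) :
    (descents π : ℝ) = ∑ j : Fin m, if π j.succ < π j.castSucc then (1 : ℝ) else 0 := by
  have h : descents π = Nat.card {j : Fin m // π j.succ < π j.castSucc} := by
    unfold descents
    refine Nat.card_congr
      { toFun := fun x => ⟨⟨x.1.1, by obtain ⟨h, _⟩ := x.2; omega⟩, ?_⟩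
        invFun := fun y => ⟨y.1.castSucc, ?_⟩
        left_inv := ?_
        right_inv := ?_ }
    · obtain ⟨h, h'⟩ := x.2
      exact h'
    · exact ⟨by have := y.1.2; simp, y.2⟩
    · intro x; rfl
    · intro x; rfl
  rw [h, Nat.card_eq_fintype_card, Fintype.card_subtype, Finset.sum_boole]

lemma sum_stepSign {m : ℕ} (π : Equiv.Perm (Fin (m + 1))) :
    ∑ j : Fin m, stepSign j π = 2 * ((descents π : ℝ) - (m : ℝ) / 2) := by
  have h : ∀ j : Fin m, stepSign j π =
      2 * (if π j.succ < π j.castSucc then (1 : ℝ) else 0) - 1 := by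
    intro j
    unfold stepSign
    split_ifs <;> norm_num
  rw [descents_eq_s19, Finset.sum_congr rfl (fun j _ => h j), Finset.sum_sub_distrib,
    ← Finset.mul_sum]
  simp
  ring

lemma stepSign_mul_le {m : ℕ} (j k : Fin m) (π : Equiv.Perm (Fin (m + 1))) :
    stepSign j π * stepSign k π ≤ 1 := by
  unfold stepSign
  split_ifs <;> norm_num

lemma stepSign_swap_self {m : ℕ} (j : Fin m) (π : Equiv.Perm (Fin (m + 1))) :
    stepSign j (π * Equiv.swap j.castSucc j.succ) = - stepSign j π := by
  unfold stepSign
  have hne : π j.succ ≠ π j.castSucc := by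
    intro h
    have := congrArg Fin.val (π.injective h)
    simp at this
  simp only [Equiv.Perm.mul_apply, Equiv.swap_apply_left, Equiv.swap_apply_right]
  rcases lt_or_gt_of_ne hne with h | h
  · rw [if_pos h, if_neg (not_lt.2 h.le)]
  · rw [if_pos h, if_neg (not_lt.2 h.le)]; norm_num

lemma stepSign_swap_far {m : ℕ} (j k : Fin m) (π : Equiv.Perm (Fin (m + 1)))
    (h : ¬ (j.1 ≤ k.1 + 1 ∧ k.1 ≤ j.1 + 1)) :
    stepSign k (π * Equiv.swap j.castSucc j.succ) = stepSign k π := by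
  have h1 : (π * Equiv.swap j.castSucc j.succ) k.succ = π k.succ := by
    rw [Equiv.Perm.mul_apply, Equiv.swap_apply_of_ne_of_ne] <;>
    · intro h'
      have := congrArg Fin.val h'
      simp at this
      omega
  have h2 : (π * Equiv.swap j.castSucc j.succ) k.castSucc = π k.castSucc := by
    rw [Equiv.Perm.mul_apply, Equiv.swap_apply_of_ne_of_ne] <;>
    · intro h'
      have := congrArg Fin.val h'
      simp at this
      omega
  unfold stepSign
  simp only [h1, h2]

lemma corr_le {m : ℕ} (j k : Fin m) :
    ∑ π : Equiv.Perm (Fin (m + 1)), stepSign j π * stepSign k π ≤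
      if j.1 ≤ k.1 + 1 ∧ k.1 ≤ j.1 + 1 then ((m + 1).factorial : ℝ) else 0 := by
  split_ifs with h
  · refine (Finset.sum_le_sum (fun π _ => stepSign_mul_le j k π)).trans ?_
    simp [Fintype.card_perm]
  · have e := Equiv.sum_comp (Equiv.mulRight (Equiv.swap j.castSucc j.succ))
      (fun π : Equiv.Perm (Fin (m + 1)) => stepSign j π * stepSign k π)
    simp only [Equiv.coe_mulRight, stepSign_swap_self, stepSign_swap_far j k _ h, neg_mul,
      Finset.sum_neg_distrib] at e
    linarith

lemma close_card {m : ℕ} (j : Fin m) :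
    (Finset.univ.filter (fun k : Fin m => j.1 ≤ k.1 + 1 ∧ k.1 ≤ j.1 + 1)).card ≤ 3 := by
  calc _ ≤ (Finset.Icc (j.1 - 1) (j.1 + 1)).card := by
        refine Finset.card_le_card_of_injOn Fin.val ?_ (Fin.val_injective.injOn)
        intro k hk
        simp at hk ⊢
        omega
    _ ≤ 3 := by simp; omega

lemma second_moment (m : ℕ) :
    ∑ π : Equiv.Perm (Fin (m + 1)), (∑ j : Fin m, stepSign j π) ^ 2 ≤
      3 * m * ((m + 1).factorial : ℝ) := by
  have h1 : ∑ π : Equiv.Perm (Fin (m + 1)), (∑ j : Fin m, stepSign j π) ^ 2 =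
      ∑ j : Fin m, ∑ k : Fin m, ∑ π : Equiv.Perm (Fin (m + 1)),
        stepSign j π * stepSign k π := by
    simp only [sq, Finset.sum_mul_sum]
    rw [Finset.sum_comm]
    refine Finset.sum_congr rfl fun j _ => ?_
    rw [Finset.sum_comm]
  rw [h1]
  calc _ ≤ ∑ j : Fin m, ∑ k : Fin m,
        (if j.1 ≤ k.1 + 1 ∧ k.1 ≤ j.1 + 1 then ((m + 1).factorial : ℝ) else 0) :=
        Finset.sum_le_sum fun j _ => Finset.sum_le_sum fun k _ => corr_le j k
    _ ≤ ∑ _j : Fin m, 3 * ((m + 1).factorial : ℝ) := by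
        refine Finset.sum_le_sum fun j _ => ?_
        rw [← Finset.sum_filter, Finset.sum_const, nsmul_eq_mul]
        gcongr
        exact_mod_cast close_card j
    _ = _ := by simp; ring

lemma chebyshev_bound (ε : ℝ) (hε : 0 < ε) (m : ℕ) (hm : 0 < m) :
    (Nat.card {π : Equiv.Perm (Fin (m + 1)) //
        ε * (m : ℝ) ≤ |(descents π : ℝ) - (m : ℝ) / 2|} : ℝ) / ((m + 1).factorial : ℝ) ≤
      3 / (4 * ε ^ 2) / m := by
  classical
  have hm' : (0 : ℝ) < m := by exact_mod_cast hm
  have hf : (0 : ℝ) < ((m + 1).factorial : ℝ) := by exact_mod_cast Nat.factorial_pos _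
  rw [Nat.card_eq_fintype_card, Fintype.card_subtype]
  set S := Finset.univ.filter (fun π : Equiv.Perm (Fin (m + 1)) =>
    ε * (m : ℝ) ≤ |(descents π : ℝ) - (m : ℝ) / 2|) with hS
  have key : (S.card : ℝ) * (4 * (ε * m) ^ 2) ≤ 3 * m * ((m + 1).factorial : ℝ) := by
    refine le_trans ?_ (second_moment m)
    calc (S.card : ℝ) * (4 * (ε * m) ^ 2) = ∑ _π ∈ S, 4 * (ε * m) ^ 2 := by simp
      _ ≤ ∑ π ∈ S, (∑ j : Fin m, stepSign j π) ^ 2 := by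
          refine Finset.sum_le_sum fun π hπ => ?_
          have h := (Finset.mem_filter.1 hπ).2
          rw [sum_stepSign, mul_pow 2, ← sq_abs ((descents π : ℝ) - (m : ℝ) / 2)]
          have : (ε * m) ^ 2 ≤ |(descents π : ℝ) - (m : ℝ) / 2| ^ 2 := by gcongr
          linarith
      _ ≤ _ := Finset.sum_le_sum_of_subset_of_nonneg (Finset.subset_univ _)
          fun _ _ _ => sq_nonneg _
  rw [div_div, div_le_div_iff₀ hf (by positivity)]
  refine le_of_mul_le_mul_right ?_ hm'
  calc _ = (S.card : ℝ) * (4 * (ε * m) ^ 2) := by ring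
    _ ≤ _ := key
    _ = _ := by ring

theorem stmt19 (ε : ℝ) (hε : 0 < ε) :
    Filter.Tendsto (fun n : ℕ =>
      (Nat.card {π : Equiv.Perm (Fin n) //
          ε * ((n : ℝ) - 1) ≤ |(descents π : ℝ) - ((n : ℝ) - 1) / 2|} : ℝ) /
        (Nat.factorial n : ℝ))
      Filter.atTop (nhds 0) := by
  rw [← Filter.tendsto_add_atTop_iff_nat 1]
  refine squeeze_zero' (Filter.Eventually.of_forall fun m => by positivity) ?_
    (tendsto_const_div_atTop_nhds_zero_nat (3 / (4 * ε ^ 2)))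
  filter_upwards [Filter.eventually_gt_atTop 0] with m hm
  have e : (((m + 1 : ℕ) : ℝ) - 1) = m := by push_cast; ring
  rw [e]
  exact chebyshev_bound ε hε m hm
end
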